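/- Assume (A3), (A5) and (A7). Let V ∈ (V_W, V_max], set J₋ := λ₋⁻¹(V) and J₊ := λ₊⁻¹(V), and assume I₋ < J₋ < J₊ < I₊. Let (f₋, f₊) be the unique solution of Luckock's equation on [J₋, J₊]. Then: (i) if Φ(V) < V_W⁻², then f₋(J₋) > 0 and f₊(J₊) > 0; (ii) if Φ(V) = V_W⁻², then f₋(J₋) = 0 and f₊(J₊) = 0; (iii) if Φ(V) > V_W⁻², then f₋(J₋) < 0 and f₊(J₊) < 0. -/

import Mathlib

open MeasureTheory Set
open scoped ENNReal

noncomputable section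

/-- The right limit of `f` at `x`, with the convention `f(b+) := f b` at the
right endpoint `b`. -/
def rLim (b : ℝ) (f : ℝ → ℝ) (x : ℝ) : ℝ :=
  if x < b then Function.rightLim f x else f b

/-- `ν` is the Lebesgue-Stieltjes signed measure `df` of `f` on the interval `[a,b]`,
with the conventions `f(a−) := f a` and `f(b+) := f b`. -/
def IsLS (a b : ℝ) (f : ℝ → ℝ) (ν : MeasureTheory.SignedMeasure ℝ) : Prop :=
  (∀ s : Set ℝ, MeasurableSet s → s ∩ Set.Icc a b = ∅ → ν s = 0) ∧
  (∀ x y : ℝ, a ≤ x → x ≤ y → y ≤ b → ν (Set.Ioc x y) = rLim b f y - rLim b f x) ∧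
  ν {a} = rLim b f a - f a

/-- The integral `∫_s g dν` of `g` over `s` against the signed measure `ν`. -/
def sInt (ν : MeasureTheory.SignedMeasure ℝ) (g : ℝ → ℝ) (s : Set ℝ) : ℝ :=
  (∫ x in s, g x ∂ν.toJordanDecomposition.posPart) -
    ∫ x in s, g x ∂ν.toJordanDecomposition.negPart

/-- Assumption (A3): `lm` (demand) is continuous and nonincreasing, `lp` (supply) is
continuous and nondecreasing on `[a,b]`; both are nonnegative. -/
def A3 (a b : ℝ) (lm lp : ℝ → ℝ) : Prop :=
  ContinuousOn lm (Set.Icc a b) ∧ ContinuousOn lp (Set.Icc a b) ∧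
  AntitoneOn lm (Set.Icc a b) ∧ MonotoneOn lp (Set.Icc a b) ∧
  (∀ x ∈ Set.Icc a b, 0 ≤ lm x) ∧ (∀ x ∈ Set.Icc a b, 0 ≤ lp x)

/-- Assumption (A6): the rates of market orders are positive. -/
def A6 (a b : ℝ) (lm lp : ℝ → ℝ) : Prop := 0 < lp a ∧ 0 < lm b

/-- `(fm, fp)` is a solution of Luckock's equation on `[a,b]` for demand/supply `lm, lp`:
both are continuous of bounded variation, `fm dlp + lm dfp = 0` and `fp dlm + lp dfm = 0`
as signed measures on `[a,b]`, and `fm b = 1 = fp a`. -/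
def LuckockSol (a b : ℝ) (lm lp fm fp : ℝ → ℝ) : Prop :=
  ContinuousOn fm (Set.Icc a b) ∧ ContinuousOn fp (Set.Icc a b) ∧
  BoundedVariationOn fm (Set.Icc a b) ∧ BoundedVariationOn fp (Set.Icc a b) ∧
  fm b = 1 ∧ fp a = 1 ∧
  ∀ νlm νlp νfm νfp : MeasureTheory.SignedMeasure ℝ,
    IsLS a b lm νlm → IsLS a b lp νlp → IsLS a b fm νfm → IsLS a b fp νfp →
    ∀ s : Set ℝ, MeasurableSet s →
      sInt νlp fm s + sInt νfp lm s = 0 ∧ sInt νlm fp s + sInt νfm lp s = 0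

/-- Assumption (A5): `lm` and `lp` are positive on the open interval `(a,b)`. -/
def A5 (a b : ℝ) (lm lp : ℝ → ℝ) : Prop := ∀ x ∈ Set.Ioo a b, 0 < lm x ∧ 0 < lp x

/-- The Walrasian volume of trade `V_W`. -/
def VWal (a b : ℝ) (lm lp : ℝ → ℝ) : ℝ :=
  sSup ((fun x => min (lm x) (lp x)) '' Set.Icc a b)

/-- The maximal volume of trade `V_max`. -/
def Vmax (a b : ℝ) (lm lp : ℝ → ℝ) : ℝ := min (lm a) (lp b)

/-- The left-continuous inverse `λ₋⁻¹(V) = sup {x ∈ [a,b] : lm x ≥ V}`. -/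
def linvm (a b : ℝ) (lm : ℝ → ℝ) (V : ℝ) : ℝ := sSup {x | x ∈ Set.Icc a b ∧ V ≤ lm x}

/-- The left-continuous inverse `λ₊⁻¹(V) = inf {x ∈ [a,b] : lp x ≥ V}`. -/
def linvp (a b : ℝ) (lp : ℝ → ℝ) (V : ℝ) : ℝ := sInf {x | x ∈ Set.Icc a b ∧ V ≤ lp x}

/-- The function `Φ(V) = ∫_{V_W}^V (1/λ₊(λ₋⁻¹(W)) + 1/λ₋(λ₊⁻¹(W))) W⁻² dW`,
with values in `[0,∞]`. -/
def Phi (a b : ℝ) (lm lp : ℝ → ℝ) (V : ℝ) : ℝ≥0∞ :=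
  ∫⁻ W in Set.Ioc (VWal a b lm lp) V,
    ENNReal.ofReal (((lp (linvm a b lm W))⁻¹ + (lm (linvp a b lp W))⁻¹) * (W ^ 2)⁻¹)

/-- Luckock's volume of trade `V_L`. -/
def VLuc (a b : ℝ) (lm lp : ℝ → ℝ) : ℝ :=
  sSup {V | V ∈ Set.Icc (VWal a b lm lp) (Vmax a b lm lp) ∧
    Phi a b lm lp V ≤ ENNReal.ofReal (((VWal a b lm lp) ^ 2)⁻¹)}

lemma rLim_eq_of_continuousOn {a b x : ℝ} {f : ℝ → ℝ} (hf : ContinuousOn f (Icc a b))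
    (hx : x ∈ Icc a b) : rLim b f x = f x := by
  unfold rLim
  split_ifs with h
  · have h1 : ContinuousWithinAt f (Icc x b) x := (hf x hx).mono (Icc_subset_Icc_left hx.1)
    exact (h1.mono_of_mem_nhdsWithin (Icc_mem_nhdsGE h)).rightLim_eq
  · rw [le_antisymm hx.2 (not_lt.1 h)]

/-- A continuous function of bounded variation has a Lebesgue-Stieltjes signed measure. -/
lemma exists_isLS {a b : ℝ} (hab : a ≤ b) {f : ℝ → ℝ} (hf : ContinuousOn f (Icc a b))
    (hbv : BoundedVariationOn f (Icc a b)) : ∃ ν : SignedMeasure ℝ, IsLS a b f ν := by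
  set F : ℝ → ℝ := IccExtend hab ((Icc a b).domRestrict f) with hF
  have hFc : Continuous F := hf.domRestrict.Icc_extend'
  have hFeq : ∀ x ∈ Icc a b, F x = f x := fun x hx => by
    rw [hF, IccExtend_of_mem hab _ hx]; rfl
  have hFbv : BoundedVariationOn F univ := by
    have h := eVariationOn.comp_le_of_monotoneOn (s := Icc a b) (t := univ) f
      (fun x => (projIcc a b hab x : ℝ)) (fun x _ y _ hxy => monotone_projIcc hab hxy)
      (fun x _ => (projIcc a b hab x).2)
    exact (h.trans_lt hbv.lt_top).ne
  have hr : ∀ x, Function.rightLim F x = F x := fun x =>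
    hFc.continuousWithinAt.rightLim_eq
  have hl : ∀ x, Function.leftLim F x = F x := fun x =>
    hFc.continuousWithinAt.leftLim_eq
  refine ⟨hFbv.vectorMeasure.restrict (Icc a b), fun s hs hsab => ?_, fun x y hax hxy hyb => ?_, ?_⟩
  · rw [VectorMeasure.restrict_apply _ measurableSet_Icc hs, hsab, VectorMeasure.empty]
  · rw [VectorMeasure.restrict_apply _ measurableSet_Icc measurableSet_Ioc,
      inter_eq_left.2 (show Ioc x y ⊆ Icc a b from fun z hz => ⟨hax.trans hz.1.le, hz.2.trans hyb⟩),
      hFbv.vectorMeasure_Ioc hxy, hr, hr,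
      rLim_eq_of_continuousOn hf ⟨hax.trans hxy, hyb⟩, rLim_eq_of_continuousOn hf ⟨hax, hxy.trans hyb⟩,
      hFeq _ ⟨hax.trans hxy, hyb⟩, hFeq _ ⟨hax, hxy.trans hyb⟩]
  · rw [VectorMeasure.restrict_apply _ measurableSet_Icc (measurableSet_singleton a),
      inter_eq_left.2 (singleton_subset_iff.2 (left_mem_Icc.2 hab)), hFbv.vectorMeasure_singleton, hr, hl,
      rLim_eq_of_continuousOn hf ⟨le_rfl, hab⟩, sub_self, sub_self]

lemma IsLS.apply_Ioc {a b x y : ℝ} {f : ℝ → ℝ} {ν : SignedMeasure ℝ} (hν : IsLS a b f ν)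
    (hf : ContinuousOn f (Icc a b)) (hax : a ≤ x) (hxy : x ≤ y) (hyb : y ≤ b) :
    ν (Ioc x y) = f y - f x := by
  rw [hν.2.1 x y hax hxy hyb, rLim_eq_of_continuousOn hf ⟨hax.trans hxy, hyb⟩,
    rLim_eq_of_continuousOn hf ⟨hax, hxy.trans hyb⟩]

/-- `D x y` is negligible on `[s,t]` with respect to the increments of some monotone function,
uniformly for `x ≤ y` close together. -/
def Negligible (s t : ℝ) (D : ℝ → ℝ → ℝ) : Prop :=
  ∃ G : ℝ → ℝ, MonotoneOn G (Icc s t) ∧ ∀ ε > 0, ∃ δ > 0, ∀ x y, s ≤ x → x ≤ y → y ≤ t →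
    y - x < δ → |D x y| ≤ ε * (G y - G x)

namespace Negligible

variable {s t : ℝ} {D E : ℝ → ℝ → ℝ}

lemma congr (h : Negligible s t D) (hDE : ∀ x y, s ≤ x → x ≤ y → y ≤ t → D x y = E x y) :
    Negligible s t E := by
  obtain ⟨G, hG, h⟩ := h
  refine ⟨G, hG, fun ε hε => ?_⟩
  obtain ⟨δ, hδ, h⟩ := h ε hε
  refine ⟨δ, hδ, fun x y hx hxy hy hd => ?_⟩
  rw [← hDE x y hx hxy hy]
  exact h x y hx hxy hy hd

lemma add (hD : Negligible s t D) (hE : Negligible s t E) :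
    Negligible s t (fun x y => D x y + E x y) := by
  obtain ⟨G, hG, hD⟩ := hD
  obtain ⟨H, hH, hE⟩ := hE
  refine ⟨fun x => G x + H x, hG.add hH, fun ε hε => ?_⟩
  obtain ⟨δ, hδ, hD⟩ := hD ε hε
  obtain ⟨δ', hδ', hE⟩ := hE ε hε
  refine ⟨min δ δ', lt_min hδ hδ', fun x y hx hxy hy hd => ?_⟩
  have h1 := hD x y hx hxy hy (hd.trans_le (min_le_left _ _))
  have h2 := hE x y hx hxy hy (hd.trans_le (min_le_right _ _))
  have h3 := abs_add_le (D x y) (E x y)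
  linarith

lemma bdd_mul (hD : Negligible s t D) {c : ℝ → ℝ → ℝ} {M : ℝ}
    (hc : ∀ x y, s ≤ x → x ≤ y → y ≤ t → |c x y| ≤ M) :
    Negligible s t (fun x y => c x y * D x y) := by
  obtain ⟨G, hG, hD⟩ := hD
  refine ⟨fun x => (|M| + 1) * G x, fun x hx y hy hxy => ?_, fun ε hε => ?_⟩
  · exact mul_le_mul_of_nonneg_left (hG hx hy hxy) (by positivity)
  obtain ⟨δ, hδ, hD⟩ := hD ε hε
  refine ⟨δ, hδ, fun x y hx hxy hy hd => ?_⟩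
  rw [abs_mul]
  calc |c x y| * |D x y| ≤ (|M| + 1) * (ε * (G y - G x)) := by
        gcongr
        · linarith [hc x y hx hxy hy, le_abs_self M]
        · exact hD x y hx hxy hy hd
    _ = ε * ((|M| + 1) * G y - (|M| + 1) * G x) := by ring

/-- A function with negligible increments is constant. -/
lemma eq_of_increment {F : ℝ → ℝ} (h : Negligible s t (fun x y => F y - F x)) {x y : ℝ}
    (hx : s ≤ x) (hxy : x ≤ y) (hy : y ≤ t) : F y = F x := by
  obtain ⟨G, hG, h⟩ := h
  have key : ∀ ε > 0, |F y - F x| ≤ ε * (G y - G x) := by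
    intro ε hε
    obtain ⟨δ, hδ, h⟩ := h ε hε
    have chain : ∀ n : ℕ, ∀ z, x ≤ z → z ≤ y → z - x ≤ n * (δ / 2) →
        |F z - F x| ≤ ε * (G z - G x) := by
      intro n
      induction n with
      | zero =>
        intro z hxz _ hz
        have : z = x := by
          simp only [Nat.cast_zero, zero_mul] at hz
          linarith
        simp [this]
      | succ n ih =>
        intro z hxz hzy hz
        push_cast at hz
        have h1 := ih (max x (z - δ / 2)) (le_max_left _ _)
          (max_le hxy (by linarith)) (by
            rcases max_cases x (z - δ / 2) with ⟨h, _⟩ | ⟨h, _⟩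
            · rw [h, sub_self]; positivity
            · rw [h]; linarith)
        have h2 := h (max x (z - δ / 2)) z (hx.trans (le_max_left _ _))
          (max_le hxz (by linarith)) (hzy.trans hy)
          (by linarith [le_max_right x (z - δ / 2)])
        have h3 := abs_sub_le (F z) (F (max x (z - δ / 2))) (F x)
        linarith
    obtain ⟨n, hn⟩ := exists_nat_ge ((y - x) / (δ / 2))
    exact chain n y hxy le_rfl ((div_le_iff₀ (by positivity)).1 hn)
  have hzero : |F y - F x| ≤ 0 := by
    by_contra! hpos
    have hGxy : 0 ≤ G y - G x := sub_nonneg.2 (hG ⟨hx, hxy.trans hy⟩ ⟨hx.trans hxy, hy⟩ hxy)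
    have h1 := key (|F y - F x| / (2 * (G y - G x + 1))) (by positivity)
    rw [div_mul_eq_mul_div, le_div_iff₀ (by positivity)] at h1
    nlinarith
  linarith [abs_nonpos_iff.1 hzero]

/-- Product of a uniformly small factor and an increment dominated by a monotone function. -/
lemma of_le_mul {g : ℝ → ℝ} (hg : ContinuousOn g (Icc s t)) {G : ℝ → ℝ}
    (hG : MonotoneOn G (Icc s t))
    (hD : ∀ x y, s ≤ x → x ≤ y → y ≤ t → ∀ η > 0, (∀ z ∈ Icc x y, |g z - g x| ≤ η) →
      |D x y| ≤ η * (G y - G x)) : Negligible s t D := by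
  refine ⟨G, hG, fun ε hε => ?_⟩
  obtain ⟨δ, hδ, h⟩ := Metric.uniformContinuousOn_iff.1
    (isCompact_Icc.uniformContinuousOn_of_continuous hg) ε hε
  refine ⟨δ, hδ, fun x y hx hxy hy hd => hD x y hx hxy hy ε hε fun z hz => ?_⟩
  have hz' := h z ⟨hx.trans hz.1, hz.2.trans hy⟩ x ⟨hx, hxy.trans hy⟩ (by
    rw [Real.dist_eq, abs_of_nonneg (sub_nonneg.2 hz.1)]
    linarith [hz.2])
  rw [Real.dist_eq] at hz'
  exact hz'.le

end Negligible

lemma abs_setIntegral_sub_le {μ : Measure ℝ} [IsFiniteMeasure μ] {g : ℝ → ℝ} {A : Set ℝ}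
    (hg : IntegrableOn g A μ) {c η : ℝ} (h : ∀ z ∈ A, |g z - c| ≤ η) :
    |∫ z in A, g z ∂μ - c * μ.real A| ≤ η * μ.real A := by
  have h1 : ∫ z in A, g z ∂μ - c * μ.real A = ∫ z in A, (g z - c) ∂μ := by
    rw [integral_sub hg (integrable_const c), setIntegral_const, smul_eq_mul, mul_comm]
  rw [h1]
  exact norm_setIntegral_le_of_norm_le_const (f := fun z => g z - c) (measure_lt_top _ _) h

/-- On short intervals, `∫ g df` is close to `g(x) (f(y) - f(x))`. -/
lemma IsLS.negligible_sInt {s t : ℝ} {f g : ℝ → ℝ} {ν : SignedMeasure ℝ} (hν : IsLS s t f ν)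
    (hf : ContinuousOn f (Icc s t)) (hg : ContinuousOn g (Icc s t)) :
    Negligible s t (fun x y => sInt ν g (Ioc x y) - g x * (f y - f x)) := by
  set μ := ν.toJordanDecomposition.posPart with hμ
  set ρ := ν.toJordanDecomposition.negPart with hρ
  have hmono : ∀ m : Measure ℝ, IsFiniteMeasure m → Monotone fun x => m.real (Ioc s x) :=
    fun m _ x y hxy => measureReal_mono (Ioc_subset_Ioc_right hxy)
  have hsplit : ∀ m : Measure ℝ, IsFiniteMeasure m → ∀ x y, s ≤ x → x ≤ y →
      m.real (Ioc x y) = m.real (Ioc s y) - m.real (Ioc s x) := by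
    intro m _ x y hx hxy
    rw [← Ioc_union_Ioc_eq_Ioc hx hxy, measureReal_union _ measurableSet_Ioc]
    · ring
    · exact Ioc_disjoint_Ioc_of_le le_rfl
  refine Negligible.of_le_mul hg (G := fun x => μ.real (Ioc s x) + ρ.real (Ioc s x))
    (((hmono μ inferInstance).add (hmono ρ inferInstance)).monotoneOn _) ?_
  intro x y hx hxy hy η _ hη
  have hsub : Ioc x y ⊆ Icc s t := fun z hz => ⟨hx.trans hz.1.le, hz.2.trans hy⟩
  have hint : ∀ m : Measure ℝ, IsFiniteMeasure m → IntegrableOn g (Ioc x y) m :=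
    fun m _ => hg.integrableOn_Icc.mono_set hsub
  have hη' : ∀ z ∈ Ioc x y, |g z - g x| ≤ η := fun z hz => hη z (Ioc_subset_Icc_self hz)
  have h1 := abs_setIntegral_sub_le (hint μ inferInstance) hη'
  have h2 := abs_setIntegral_sub_le (hint ρ inferInstance) hη'
  have h3 : f y - f x = μ.real (Ioc x y) - ρ.real (Ioc x y) := by
    rw [← hν.apply_Ioc hf hx hxy hy]
    exact ν.apply_eq_posPart_real_sub_negPart_real measurableSet_Ioc
  have h4 : sInt ν g (Ioc x y) - g x * (f y - f x) =
      (∫ z in Ioc x y, g z ∂μ - g x * μ.real (Ioc x y)) -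
        (∫ z in Ioc x y, g z ∂ρ - g x * ρ.real (Ioc x y)) := by
    rw [h3, sInt]; ring
  rw [h4]
  refine (abs_sub _ _).trans ((add_le_add h1 h2).trans_eq ?_)
  rw [hsplit μ inferInstance x y hx hxy, hsplit ρ inferInstance x y hx hxy]
  ring

lemma integral_inv_sq_of_pos {p q : ℝ} (hp : 0 < p) (hq : 0 < q) :
    IntervalIntegrable (fun W : ℝ => (W ^ 2)⁻¹) volume p q ∧
      ∫ W in p..q, (W ^ 2)⁻¹ = (q - p) * p⁻¹ * q⁻¹ := by
  have hpos : ∀ W ∈ uIcc p q, 0 < W := fun W hW => (lt_min hp hq).trans_le hW.1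
  have hint : IntervalIntegrable (fun W : ℝ => (W ^ 2)⁻¹) volume p q :=
    ((continuousOn_id.pow 2).inv₀ fun W hW => (pow_pos (hpos W hW) 2).ne').intervalIntegrable
  refine ⟨hint, ?_⟩
  rw [intervalIntegral.integral_eq_sub_of_hasDerivAt (f := fun W => -W⁻¹) (fun W hW => ?_) hint]
  · field_simp
    ring
  · simpa using (hasDerivAt_inv (hpos W hW).ne').fun_neg

/-- `f v + h u` is a first integral of `h du + v df = 0`, `f dv + u dh = 0`. -/
lemma first_integral {s t : ℝ} {u v f h Gu Gv : ℝ → ℝ}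
    (hf : ContinuousOn f (Icc s t)) (hh : ContinuousOn h (Icc s t))
    (hGu : MonotoneOn Gu (Icc s t))
    (hu : ∀ x y, s ≤ x → x ≤ y → y ≤ t → |u y - u x| ≤ Gu y - Gu x)
    (hGv : MonotoneOn Gv (Icc s t))
    (hv : ∀ x y, s ≤ x → x ≤ y → y ≤ t → |v y - v x| ≤ Gv y - Gv x)
    (hD : Negligible s t (fun x y => h x * (u y - u x) + v x * (f y - f x)))
    (hE : Negligible s t (fun x y => f x * (v y - v x) + u x * (h y - h x)))
    {x y : ℝ} (hx : s ≤ x) (hxy : x ≤ y) (hy : y ≤ t) :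
    f y * v y + h y * u y = f x * v x + h x * u x := by
  have key : ∀ (w k Gw : ℝ → ℝ), ContinuousOn k (Icc s t) → MonotoneOn Gw (Icc s t) →
      (∀ x y, s ≤ x → x ≤ y → y ≤ t → |w y - w x| ≤ Gw y - Gw x) →
      Negligible s t (fun x y => (k y - k x) * (w y - w x)) := by
    intro w k Gw hk hGw hw
    refine Negligible.of_le_mul hk hGw fun x y hx hxy hy η hη hz => ?_
    rw [abs_mul]
    exact mul_le_mul (hz y ⟨hxy, le_rfl⟩) (hw x y hx hxy hy) (abs_nonneg _) hη.le
  refine Negligible.eq_of_increment (F := fun x => f x * v x + h x * u x) ?_ hx hxy hy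
  refine (((hD.add hE).add (key v f Gv hf hGv hv)).add (key u h Gu hh hGu hu)).congr ?_
  intro x y _ _ _
  ring

/-- Integration of `d(f/u) = -C du/(v u²)`, with the right-hand side expressed as an integral
over the range of `u`. -/
lemma ratio_increment {s t C : ℝ} {u v f h g Gu : ℝ → ℝ}
    (huc : ContinuousOn u (Icc s t)) (hvc : ContinuousOn v (Icc s t))
    (hu0 : ∀ x ∈ Icc s t, 0 < u x) (hv0 : ∀ x ∈ Icc s t, 0 < v x)
    (hGu : MonotoneOn Gu (Icc s t))
    (hu : ∀ x y, s ≤ x → x ≤ y → y ≤ t → |u y - u x| ≤ Gu y - Gu x)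
    (hD : Negligible s t (fun x y => h x * (u y - u x) + v x * (f y - f x)))
    (hC : ∀ x ∈ Icc s t, f x * v x + h x * u x = C)
    (hint : ∀ x ∈ Icc s t, ∀ y ∈ Icc s t, IntervalIntegrable g volume (u x) (u y))
    (hg : ∀ x y, s ≤ x → x ≤ y → y ≤ t → ∀ W ∈ uIoc (u x) (u y),
      ∃ z ∈ Icc x y, g W = (v z)⁻¹ * (W ^ 2)⁻¹)
    {x y : ℝ} (hx : s ≤ x) (hxy : x ≤ y) (hy : y ≤ t) :
    f y / u y + C * (∫ W in u x..u y, g W) = f x / u x := by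
  have hs : s ∈ Icc s t := ⟨le_rfl, hx.trans (hxy.trans hy)⟩
  obtain ⟨M, hM⟩ := isCompact_Icc.exists_bound_of_continuousOn
    (huc.inv₀ fun x hx => (hu0 x hx).ne')
  obtain ⟨N, hN⟩ := isCompact_Icc.exists_bound_of_continuousOn
    (hvc.inv₀ fun x hx => (hv0 x hx).ne')
  have hM0 : 0 ≤ M := (norm_nonneg _).trans (hM s hs)
  have hN0 : 0 ≤ N := (norm_nonneg _).trans (hN s hs)
  have hE : Negligible s t (fun x y =>
      (∫ W in u x..u y, g W) - (v x)⁻¹ * ((u y - u x) * (u x)⁻¹ * (u y)⁻¹)) := by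
    refine Negligible.of_le_mul (g := fun x => (v x)⁻¹) (G := fun x => M ^ 2 * Gu x)
      (hvc.inv₀ fun x hx => (hv0 x hx).ne')
      (fun x hx y hy hxy => mul_le_mul_of_nonneg_left (hGu hx hy hxy) (by positivity)) ?_
    intro x y hx hxy hy η hη hz
    have hxm : x ∈ Icc s t := ⟨hx, hxy.trans hy⟩
    have hym : y ∈ Icc s t := ⟨hx.trans hxy, hy⟩
    obtain ⟨hi, hi'⟩ := integral_inv_sq_of_pos (hu0 x hxm) (hu0 y hym)
    rw [← hi', ← intervalIntegral.integral_const_mul,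
      ← intervalIntegral.integral_sub (hint x hxm y hym) (hi.const_mul _)]
    have hb : ∀ W ∈ uIoc (u x) (u y), ‖g W - (v x)⁻¹ * (W ^ 2)⁻¹‖ ≤ η * M ^ 2 := by
      intro W hW
      obtain ⟨z, hzm, hz'⟩ := hg x y hx hxy hy W hW
      rw [hz', ← sub_mul, norm_mul]
      refine mul_le_mul (hz z hzm) ?_ (norm_nonneg _) hη.le
      have hmin : 0 < min (u x) (u y) := lt_min (hu0 x hxm) (hu0 y hym)
      have hW0 : 0 < W := hmin.trans hW.1
      have hle : (min (u x) (u y))⁻¹ ≤ M := by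
        rcases min_cases (u x) (u y) with ⟨h, _⟩ | ⟨h, _⟩
        · rw [h]; exact (le_abs_self _).trans (hM x hxm)
        · rw [h]; exact (le_abs_self _).trans (hM y hym)
      rw [← inv_pow, norm_pow, Real.norm_of_nonneg (inv_nonneg.2 hW0.le)]
      exact pow_le_pow_left₀ (inv_nonneg.2 hW0.le) ((inv_anti₀ hmin hW.1.le).trans hle) 2
    refine (intervalIntegral.norm_integral_le_of_norm_le_const hb).trans ?_
    have := mul_le_mul_of_nonneg_left (hu x y hx hxy hy) (by positivity : 0 ≤ η * M ^ 2)
    linarith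
  have hD' := hD.bdd_mul (c := fun x y => (v x)⁻¹ * (u y)⁻¹) (M := N * M)
    (fun x y hx hxy hy => by
      rw [abs_mul]
      exact mul_le_mul (hN x ⟨hx, hxy.trans hy⟩) (hM y ⟨hx.trans hxy, hy⟩) (abs_nonneg _) hN0)
  have hE' := hE.bdd_mul (c := fun _ _ => C) (M := |C|) (fun _ _ _ _ _ => le_rfl)
  have hsub : ∀ x ∈ Icc s t, ∀ y ∈ Icc s t,
      (∫ W in u s..u y, g W) - ∫ W in u s..u x, g W = ∫ W in u x..u y, g W :=
    fun x hx y hy => intervalIntegral.integral_interval_sub_left (hint s hs y hy) (hint s hs x hx)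
  have hF : Negligible s t (fun x y => (f y / u y + C * ∫ W in u s..u y, g W) -
      (f x / u x + C * ∫ W in u s..u x, g W)) := by
    refine (hD'.add hE').congr fun x y hx hxy hy => ?_
    have hxm : x ∈ Icc s t := ⟨hx, hxy.trans hy⟩
    have hym : y ∈ Icc s t := ⟨hx.trans hxy, hy⟩
    have h1 := hsub x hxm y hym
    have h2 := hu0 x hxm
    have h3 := hu0 y hym
    have h4 := hv0 x hxm
    rw [← h1, ← hC x hxm]
    field_simp
    ring
  have h := hF.eq_of_increment (F := fun x => f x / u x + C * ∫ W in u s..u x, g W) hx hxy hy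
  have h1 := hsub x ⟨hx, hxy.trans hy⟩ y ⟨hx.trans hxy, hy⟩
  rw [← h1]
  linarith

lemma LuckockSol.negligible {s t : ℝ} {lm lp fm fp : ℝ → ℝ} (hst : s ≤ t)
    (hsol : LuckockSol s t lm lp fm fp) (hlm : ContinuousOn lm (Icc s t))
    (hlp : ContinuousOn lp (Icc s t)) (hlm' : AntitoneOn lm (Icc s t))
    (hlp' : MonotoneOn lp (Icc s t)) :
    Negligible s t (fun x y => fm x * (lp y - lp x) + lm x * (fp y - fp x)) ∧
      Negligible s t (fun x y => fp x * (lm y - lm x) + lp x * (fm y - fm x)) := by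
  obtain ⟨hfm, hfp, hfm', hfp', -, -, h⟩ := hsol
  have hbvp : BoundedVariationOn lp (Icc s t) := by
    obtain ⟨M, hM⟩ := isCompact_Icc.exists_bound_of_continuousOn hlp
    exact hlp'.boundedVariationOn hM
  have hbvm : BoundedVariationOn lm (Icc s t) := by
    obtain ⟨M, hM⟩ := isCompact_Icc.exists_bound_of_continuousOn hlm.neg
    have := (LipschitzWith.id (α := ℝ)).neg.comp_boundedVariationOn (hlm'.neg.boundedVariationOn hM)
    refine (congrArg (fun k => BoundedVariationOn k (Icc s t)) ?_).mp this
    ext x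
    simp
  obtain ⟨νlm, hνlm⟩ := exists_isLS hst hlm hbvm
  obtain ⟨νlp, hνlp⟩ := exists_isLS hst hlp hbvp
  obtain ⟨νfm, hνfm⟩ := exists_isLS hst hfm hfm'
  obtain ⟨νfp, hνfp⟩ := exists_isLS hst hfp hfp'
  have h' := fun x y => h νlm νlp νfm νfp hνlm hνlp hνfm hνfp (Ioc x y) measurableSet_Ioc
  constructor
  · refine (((hνlp.negligible_sInt hlp hfm).add (hνfp.negligible_sInt hfp hlm)).bdd_mul
      (c := fun _ _ => -1) (M := 1) (by simp)).congr fun x y _ _ _ => ?_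
    linear_combination -(h' x y).1
  · refine (((hνlm.negligible_sInt hlm hfp).add (hνfm.negligible_sInt hfm hlp)).bdd_mul
      (c := fun _ _ => -1) (M := 1) (by simp)).congr fun x y _ _ _ => ?_
    linear_combination -(h' x y).2

lemma linvm_mem_Icc {a b x y W : ℝ} {lm : ℝ → ℝ} (hlm : AntitoneOn lm (Icc a b))
    (hx : x ∈ Icc a b) (hy : y ∈ Icc a b) (hWy : lm y < W) (hWx : W ≤ lm x) :
    linvm a b lm W ∈ Icc x y := by
  have hub : y ∈ upperBounds {z | z ∈ Icc a b ∧ W ≤ lm z} := by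
    intro z hz
    by_contra! h
    exact (hWy.trans_le hz.2).not_ge (hlm hy hz.1 h.le)
  exact ⟨le_csSup ⟨y, hub⟩ ⟨hx, hWx⟩, csSup_le ⟨x, hx, hWx⟩ hub⟩

lemma linvp_mem_Icc {a b x y W : ℝ} {lp : ℝ → ℝ} (hlp : MonotoneOn lp (Icc a b))
    (hx : x ∈ Icc a b) (hy : y ∈ Icc a b) (hWx : lp x < W) (hWy : W ≤ lp y) :
    linvp a b lp W ∈ Icc x y := by
  have hlb : x ∈ lowerBounds {z | z ∈ Icc a b ∧ W ≤ lp z} := by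
    intro z hz
    by_contra! h
    exact (hWx.trans_le hz.2).not_ge (hlp hz.1 hx h.le)
  exact ⟨le_csInf ⟨y, hy, hWy⟩ hlb, csInf_le ⟨x, hlb⟩ ⟨hy, hWy⟩⟩

lemma apply_linvm {a b V : ℝ} {lm : ℝ → ℝ} (hab : a ≤ b) (hlm : ContinuousOn lm (Icc a b))
    (hV : V ≤ lm a) (hb : linvm a b lm V < b) : lm (linvm a b lm V) = V := by
  have hbdd : BddAbove {x | x ∈ Icc a b ∧ V ≤ lm x} := ⟨b, fun x hx => hx.1.2⟩
  have hclosed : IsClosed {x | x ∈ Icc a b ∧ V ≤ lm x} :=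
    hlm.preimage_isClosed_of_isClosed isClosed_Icc isClosed_Ici
  obtain ⟨hJ, hJV⟩ : linvm a b lm V ∈ {x | x ∈ Icc a b ∧ V ≤ lm x} :=
    hclosed.csSup_mem ⟨a, ⟨le_rfl, hab⟩, hV⟩ hbdd
  by_contra hne
  have hlmb : lm b < V := by
    by_contra! h
    exact hb.not_ge (le_csSup hbdd ⟨⟨hab, le_rfl⟩, h⟩)
  obtain ⟨z, hz, hzV⟩ := intermediate_value_Icc' hJ.2 (hlm.mono (Icc_subset_Icc_left hJ.1))
    ⟨hlmb.le, hJV⟩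
  have : z ≤ linvm a b lm V := le_csSup hbdd ⟨⟨hJ.1.trans hz.1, hz.2⟩, hzV.ge⟩
  exact hne (le_antisymm hz.1 this ▸ hzV)

lemma apply_linvp {a b V : ℝ} {lp : ℝ → ℝ} (hab : a ≤ b) (hlp : ContinuousOn lp (Icc a b))
    (hV : V ≤ lp b) (ha : a < linvp a b lp V) : lp (linvp a b lp V) = V := by
  have hbdd : BddBelow {x | x ∈ Icc a b ∧ V ≤ lp x} := ⟨a, fun x hx => hx.1.1⟩
  have hclosed : IsClosed {x | x ∈ Icc a b ∧ V ≤ lp x} :=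
    hlp.preimage_isClosed_of_isClosed isClosed_Icc isClosed_Ici
  obtain ⟨hJ, hJV⟩ : linvp a b lp V ∈ {x | x ∈ Icc a b ∧ V ≤ lp x} :=
    hclosed.csInf_mem ⟨b, ⟨hab, le_rfl⟩, hV⟩ hbdd
  by_contra hne
  have hlpa : lp a < V := by
    by_contra! h
    exact ha.not_ge (csInf_le hbdd ⟨⟨le_rfl, hab⟩, h⟩)
  obtain ⟨z, hz, hzV⟩ := intermediate_value_Icc hJ.1 (hlp.mono (Icc_subset_Icc_right hJ.2))
    ⟨hlpa.le, hJV⟩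
  have : linvp a b lp V ≤ z := csInf_le hbdd ⟨⟨hz.1, hz.2.trans hJ.2⟩, hzV.ge⟩
  exact hne (le_antisymm hz.2 this ▸ hzV)

/-- The Walrasian volume is the common value of demand and supply at an equilibrium price. -/
lemma VWal_eq {a b x : ℝ} {lm lp : ℝ → ℝ} (hlm : AntitoneOn lm (Icc a b))
    (hlp : MonotoneOn lp (Icc a b)) (hx : x ∈ Icc a b) (h : lm x = lp x) :
    VWal a b lm lp = lm x := by
  refine IsGreatest.csSup_eq ⟨⟨x, hx, by simp [h]⟩, ?_⟩
  rintro _ ⟨z, hz, rfl⟩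
  rcases le_total z x with hzx | hzx
  · exact (min_le_right _ _).trans ((hlp hz hx hzx).trans h.ge)
  · exact (min_le_left _ _).trans (hlm hx hz hzx)

lemma min_le_VWal {a b x : ℝ} {lm lp : ℝ → ℝ} (hlm : AntitoneOn lm (Icc a b))
    (hx : x ∈ Icc a b) : min (lm x) (lp x) ≤ VWal a b lm lp := by
  refine le_csSup ⟨lm a, ?_⟩ ⟨x, hx, rfl⟩
  rintro _ ⟨z, hz, rfl⟩
  exact (min_le_left _ _).trans (hlm ⟨le_rfl, hx.1.trans hx.2⟩ hz hz.1)

lemma intervalIntegrable_linvm {a b J B : ℝ} {lm lp : ℝ → ℝ} (hlp : MonotoneOn lp (Icc a b))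
    (hJ : J ∈ Icc a b) (hJ0 : 0 < lp J) (hB : 0 < B) (hBJ : B ≤ lm J) :
    IntervalIntegrable (fun W => (lp (linvm a b lm W))⁻¹ * (W ^ 2)⁻¹) volume B (lm J) := by
  have hbdd : ∀ W, BddAbove {x | x ∈ Icc a b ∧ W ≤ lm x} := fun W => ⟨b, fun x hx => hx.1.2⟩
  have hmem : ∀ W ≤ lm J, linvm a b lm W ∈ Icc a b ∧ J ≤ linvm a b lm W := by
    intro W hW
    have hJW : J ≤ linvm a b lm W := le_csSup (hbdd W) ⟨hJ, hW⟩
    exact ⟨⟨hJ.1.trans hJW, csSup_le ⟨J, hJ, hW⟩ fun x hx => hx.1.2⟩, hJW⟩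
  refine IntervalIntegrable.mul_continuousOn (MonotoneOn.intervalIntegrable ?_) ?_
  · rw [uIcc_of_le hBJ]
    intro W hW W' hW' hWW'
    have hle : linvm a b lm W' ≤ linvm a b lm W :=
      csSup_le_csSup (hbdd W) ⟨J, hJ, hW'.2⟩ fun x hx => ⟨hx.1, hWW'.trans hx.2⟩
    obtain ⟨h1, -⟩ := hmem W hW.2
    obtain ⟨h2, h3⟩ := hmem W' hW'.2
    exact inv_anti₀ (hJ0.trans_le (hlp hJ h2 h3)) (hlp h2 h1 hle)
  · rw [uIcc_of_le hBJ]
    exact (continuousOn_id.pow 2).inv₀ fun W hW => (pow_pos (hB.trans_le hW.1) 2).ne'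

lemma intervalIntegrable_linvp {a b J A : ℝ} {lm lp : ℝ → ℝ} (hlm : AntitoneOn lm (Icc a b))
    (hJ : J ∈ Icc a b) (hJ0 : 0 < lm J) (hA : 0 < A) (hAJ : A ≤ lp J) :
    IntervalIntegrable (fun W => (lm (linvp a b lp W))⁻¹ * (W ^ 2)⁻¹) volume A (lp J) := by
  have hbdd : ∀ W, BddBelow {x | x ∈ Icc a b ∧ W ≤ lp x} := fun W => ⟨a, fun x hx => hx.1.1⟩
  have hmem : ∀ W ≤ lp J, linvp a b lp W ∈ Icc a b ∧ linvp a b lp W ≤ J := by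
    intro W hW
    have hJW : linvp a b lp W ≤ J := csInf_le (hbdd W) ⟨hJ, hW⟩
    exact ⟨⟨le_csInf ⟨J, hJ, hW⟩ fun x hx => hx.1.1, hJW.trans hJ.2⟩, hJW⟩
  refine IntervalIntegrable.mul_continuousOn (MonotoneOn.intervalIntegrable ?_) ?_
  · rw [uIcc_of_le hAJ]
    intro W hW W' hW' hWW'
    have hle : linvp a b lp W ≤ linvp a b lp W' :=
      csInf_le_csInf (hbdd W) ⟨J, hJ, hW'.2⟩ fun x hx => ⟨hx.1, hWW'.trans hx.2⟩
    obtain ⟨h1, -⟩ := hmem W hW.2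
    obtain ⟨h2, h3⟩ := hmem W' hW'.2
    exact inv_anti₀ (hJ0.trans_le (hlm h2 hJ h3)) (hlm h1 h2 hle)
  · rw [uIcc_of_le hAJ]
    exact (continuousOn_id.pow 2).inv₀ fun W hW => (pow_pos (hA.trans_le hW.1) 2).ne'

/-- symmetric subintervals: assume (A3), (A5) and (A7).  For
`V ∈ (V_W, V_max]`, set `J₋ := λ₋⁻¹(V)`, `J₊ := λ₊⁻¹(V)` and assume
`I₋ < J₋ < J₊ < I₊`.  Let `(fm, fp)` be the unique solution of Luckock's equation on
`[J₋, J₊]`.  Then `Φ(V) < V_W⁻²` implies `fm J₋ > 0 ∧ fp J₊ > 0`, `Φ(V) = V_W⁻²`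
implies `fm J₋ = 0 ∧ fp J₊ = 0`, and `Φ(V) > V_W⁻²` implies `fm J₋ < 0 ∧ fp J₊ < 0`. -/
theorem stmt12 (a b : ℝ) (hab : a < b) (lm lp : ℝ → ℝ)
    (hA3 : A3 a b lm lp) (hA5 : A5 a b lm lp)
    (hA7 : VWal a b lm lp < Vmax a b lm lp)
    (V : ℝ) (hV1 : VWal a b lm lp < V) (hV2 : V ≤ Vmax a b lm lp)
    (Jm Jp : ℝ) (hJm : Jm = linvm a b lm V) (hJp : Jp = linvp a b lp V)
    (haJm : a < Jm) (hJmJp : Jm < Jp) (hJpb : Jp < b)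
    (fm fp : ℝ → ℝ) (hsol : LuckockSol Jm Jp lm lp fm fp) :
    (Phi a b lm lp V < ENNReal.ofReal ((VWal a b lm lp ^ 2)⁻¹) →
      0 < fm Jm ∧ 0 < fp Jp) ∧
    (Phi a b lm lp V = ENNReal.ofReal ((VWal a b lm lp ^ 2)⁻¹) →
      fm Jm = 0 ∧ fp Jp = 0) ∧
    (ENNReal.ofReal ((VWal a b lm lp ^ 2)⁻¹) < Phi a b lm lp V →
      fm Jm < 0 ∧ fp Jp < 0) := by
  obtain ⟨hlmc, hlpc, hlm, hlp, -, -⟩ := hA3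
  have hJm' : Jm ∈ Icc a b := ⟨haJm.le, (hJmJp.trans hJpb).le⟩
  have hJp' : Jp ∈ Icc a b := ⟨(haJm.trans hJmJp).le, hJpb.le⟩
  have hsub : Icc Jm Jp ⊆ Icc a b := Icc_subset_Icc hJm'.1 hJp'.2
  have hpos : ∀ x ∈ Icc Jm Jp, 0 < lm x ∧ 0 < lp x := fun x hx =>
    hA5 x ⟨haJm.trans_le hx.1, hx.2.trans_lt hJpb⟩
  have hlmJ : lm Jm = V := by
    rw [hJm]
    exact apply_linvm hab.le hlmc (hV2.trans (min_le_left _ _)) (hJm ▸ hJmJp.trans hJpb)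
  have hlpJ : lp Jp = V := by
    rw [hJp]
    exact apply_linvp hab.le hlpc (hV2.trans (min_le_right _ _)) (hJp ▸ haJm.trans hJmJp)
  have hJmm : Jm ∈ Icc Jm Jp := ⟨le_rfl, hJmJp.le⟩
  have hJpm : Jp ∈ Icc Jm Jp := ⟨hJmJp.le, le_rfl⟩
  obtain ⟨xs, hxs, hxs'⟩ : ∃ xs ∈ Icc Jm Jp, lm xs = lp xs := by
    have h1 : lp Jm ≤ lm Jm := by
      rcases min_le_iff.1 ((min_le_VWal (lp := lp) hlm hJm').trans hV1.le) with h | h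
      · by_contra! hlt
        have := min_le_VWal (lp := lp) hlm hJm'
        rw [min_eq_left hlt.le] at this
        linarith
      · linarith
    have h2 : lm Jp ≤ lp Jp := by
      by_contra! hlt
      have := min_le_VWal (lp := lp) hlm hJp'
      rw [min_eq_right hlt.le] at this
      linarith
    obtain ⟨z, hz, hz0⟩ := intermediate_value_Icc' hJmJp.le
      ((hlmc.sub hlpc).mono hsub) ⟨sub_nonpos.2 h2, sub_nonneg.2 h1⟩
    exact ⟨z, hz, sub_eq_zero.1 hz0⟩
  have hVW : VWal a b lm lp = lm xs := VWal_eq hlm hlp (hsub hxs) hxs'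
  set gp : ℝ → ℝ := fun W => (lm (linvp a b lp W))⁻¹ * (W ^ 2)⁻¹ with hgp
  set gm : ℝ → ℝ := fun W => (lp (linvm a b lm W))⁻¹ * (W ^ 2)⁻¹ with hgm
  have hgp_eq : ∀ x y, Jm ≤ x → x ≤ y → y ≤ Jp → ∀ W ∈ uIoc (lp x) (lp y),
      ∃ z ∈ Icc x y, gp W = (lm z)⁻¹ * (W ^ 2)⁻¹ := by
    intro x y hx hxy hy W hW
    have hxm := hsub ⟨hx, hxy.trans hy⟩
    have hym := hsub ⟨hx.trans hxy, hy⟩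
    rw [uIoc_of_le (hlp hxm hym hxy)] at hW
    exact ⟨_, linvp_mem_Icc hlp hxm hym hW.1 hW.2, rfl⟩
  have hgm_eq : ∀ x y, Jm ≤ x → x ≤ y → y ≤ Jp → ∀ W ∈ uIoc (lm x) (lm y),
      ∃ z ∈ Icc x y, gm W = (lp z)⁻¹ * (W ^ 2)⁻¹ := by
    intro x y hx hxy hy W hW
    have hxm := hsub ⟨hx, hxy.trans hy⟩
    have hym := hsub ⟨hx.trans hxy, hy⟩
    rw [uIoc_of_ge (hlm hxm hym hxy)] at hW
    exact ⟨_, linvm_mem_Icc hlm hxm hym hW.1 hW.2, rfl⟩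
  have hgp_int : ∀ x ∈ Icc Jm Jp, ∀ y ∈ Icc Jm Jp,
      IntervalIntegrable gp volume (lp x) (lp y) := by
    have h : ∀ x ∈ Icc Jm Jp, IntervalIntegrable gp volume (lp x) (lp Jp) := fun x hx =>
      intervalIntegrable_linvp hlm hJp' (hpos Jp hJpm).1 (hpos x hx).2 (hlp (hsub hx) hJp' hx.2)
    exact fun x hx y hy => (h x hx).trans (h y hy).symm
  have hgm_int : ∀ x ∈ Icc Jm Jp, ∀ y ∈ Icc Jm Jp,
      IntervalIntegrable gm volume (lm x) (lm y) := by
    have h : ∀ x ∈ Icc Jm Jp, IntervalIntegrable gm volume (lm x) (lm Jm) := fun x hx =>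
      intervalIntegrable_linvm hlp hJm' (hpos Jm hJmm).2 (hpos x hx).1 (hlm hJm' (hsub hx) hx.1)
    exact fun x hx y hy => (h x hx).trans (h y hy).symm
  have hlpinc : ∀ x y, Jm ≤ x → x ≤ y → y ≤ Jp → |lp y - lp x| ≤ lp y - lp x :=
    fun x y hx hxy hy => (abs_of_nonneg (sub_nonneg.2
      (hlp (hsub ⟨hx, hxy.trans hy⟩) (hsub ⟨hx.trans hxy, hy⟩) hxy))).le
  have hlminc : ∀ x y, Jm ≤ x → x ≤ y → y ≤ Jp → |lm y - lm x| ≤ -lm y - -lm x := by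
    intro x y hx hxy hy
    rw [abs_of_nonpos (sub_nonpos.2
      (hlm (hsub ⟨hx, hxy.trans hy⟩) (hsub ⟨hx.trans hxy, hy⟩) hxy))]
    linarith
  have hlmc' := hlmc.mono hsub
  have hlpc' := hlpc.mono hsub
  have hlm' := hlm.mono hsub
  have hlp' := hlp.mono hsub
  obtain ⟨hDp, hDm⟩ := hsol.negligible hJmJp.le hlmc' hlpc' hlm' hlp'
  obtain ⟨hfmc, hfpc, -, -, hfm1, hfp1, -⟩ := hsol
  obtain ⟨C, hC⟩ : ∃ C, ∀ x ∈ Icc Jm Jp, fp x * lm x + fm x * lp x = C :=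
    ⟨_, fun x hx => first_integral hfpc hfmc hlp' hlpinc hlm'.neg hlminc hDp hDm le_rfl hx.1 hx.2⟩
  have hratp : ∀ {x y}, Jm ≤ x → x ≤ y → y ≤ Jp →
      fp y / lp y + C * (∫ W in lp x..lp y, gp W) = fp x / lp x :=
    ratio_increment hlpc' hlmc' (fun x hx => (hpos x hx).2) (fun x hx => (hpos x hx).1) hlp'
      hlpinc hDp hC hgp_int hgp_eq
  have hratm : ∀ {x y}, Jm ≤ x → x ≤ y → y ≤ Jp →
      fm y / lm y + C * (∫ W in lm x..lm y, gm W) = fm x / lm x :=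
    ratio_increment hlmc' hlpc' (fun x hx => (hpos x hx).1) (fun x hx => (hpos x hx).2) hlm'.neg
      hlminc hDm (fun x hx => by rw [add_comm]; exact hC x hx) hgm_int hgm_eq
  obtain ⟨hV0, hA⟩ := hpos Jm hJmm
  have hB := (hpos Jp hJpm).1
  have hW0 := (hpos xs hxs).1
  have hCm := hC Jm hJmm
  have hCp := hC Jp hJpm
  have hCs := hC xs hxs
  rw [hfp1, hlmJ, one_mul] at hCm
  rw [hfm1, hlpJ, one_mul] at hCp
  rw [← hxs'] at hCs
  rw [hlmJ] at hV0
  have hgp_nonneg : ∀ W ∈ Ioc (lp Jm) V, 0 ≤ gp W := by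
    intro W hW
    obtain ⟨z, hz, hz'⟩ := hgp_eq Jm Jp le_rfl hJmJp.le le_rfl W (by
      rwa [uIoc_of_le (hlp hJm' hJp' hJmJp.le), hlpJ])
    rw [hz']
    exact mul_nonneg (inv_nonneg.2 (hpos z hz).1.le) (inv_nonneg.2 (sq_nonneg W))
  have hgm_nonneg : ∀ W ∈ Ioc (lm Jp) V, 0 ≤ gm W := by
    intro W hW
    obtain ⟨z, hz, hz'⟩ := hgm_eq Jm Jp le_rfl hJmJp.le le_rfl W (by
      rwa [uIoc_of_ge (hlm hJm' hJp' hJmJp.le), hlmJ])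
    rw [hz']
    exact mul_nonneg (inv_nonneg.2 (hpos z hz).2.le) (inv_nonneg.2 (sq_nonneg W))
  have hC0 : 0 < C := by
    by_contra! hneg
    have h1 := hratp (x := Jm) (y := Jp) le_rfl hJmJp.le le_rfl
    have h2 : 0 ≤ ∫ W in lp Jm..lp Jp, gp W := by
      rw [intervalIntegral.integral_of_le (hlp hJm' hJp' hJmJp.le), hlpJ]
      exact setIntegral_nonneg measurableSet_Ioc hgp_nonneg
    have h3 : 0 < fp Jm / lp Jm := by rw [hfp1]; positivity
    have h4 : 0 < fp Jp / lp Jp := by nlinarith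
    rw [hlpJ] at h4
    have h5 := (div_pos_iff_of_pos_right hV0).1 h4
    nlinarith [mul_pos h5 hB]
  have hlpxs : lp Jm ≤ lm xs := hxs' ▸ hlp hJm' (hsub hxs) hxs.1
  have hlmxs : lm Jp ≤ lm xs := hlm (hsub hxs) hJp' hxs.2
  have hxsV : lm xs ≤ V := hVW ▸ hV1.le
  have hip : IntervalIntegrable gp volume (lm xs) V := by
    have := hgp_int xs hxs Jp hJpm
    rwa [hlpJ, ← hxs'] at this
  have him : IntervalIntegrable gm volume (lm xs) V := by
    have := hgm_int xs hxs Jm hJmm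
    rwa [hlmJ] at this
  have hPhi : Phi a b lm lp V =
      ENNReal.ofReal ((∫ W in lm xs..V, gm W) + ∫ W in lm xs..V, gp W) := by
    rw [← intervalIntegral.integral_add him hip, intervalIntegral.integral_of_le hxsV,
      ofReal_integral_eq_lintegral_ofReal ((him.add hip).1)]
    · rw [Phi, hVW]
      simp only [hgm, hgp, add_mul]
    · refine (ae_restrict_iff' measurableSet_Ioc).2 (Filter.Eventually.of_forall fun W hW => ?_)
      exact add_nonneg (hgm_nonneg W ⟨hlmxs.trans_lt hW.1, hW.2⟩)
        (hgp_nonneg W ⟨hlpxs.trans_lt hW.1, hW.2⟩)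
  have hep := hratp hxs.1 hxs.2 le_rfl
  have hem := hratm le_rfl hxs.1 hxs.2
  rw [hlpJ, ← hxs'] at hep
  rw [hlmJ, intervalIntegral.integral_symm] at hem
  set R := (∫ W in lm xs..V, gm W) + ∫ W in lm xs..V, gp W with hR
  have hsum : fm Jm + fp Jp = V * C * (((lm xs) ^ 2)⁻¹ - R) := by
    have h1 : (fm Jm + fp Jp) / V = (fp xs + fm xs) / lm xs - C * R := by
      rw [add_div, add_div, hR]
      linear_combination hep - hem
    have h2 : (fp xs + fm xs) / lm xs = C * ((lm xs) ^ 2)⁻¹ := by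
      rw [← hCs]
      field_simp
    rw [h2, div_eq_iff hV0.ne'] at h1
    linear_combination h1
  have hVC : 0 < V * C := mul_pos hV0 hC0
  have hAB : fm Jm * lp Jm = fp Jp * lm Jp := by linarith
  have hfm : fm Jm = (fm Jm + fp Jp) * (lm Jp / (lp Jm + lm Jp)) := by
    field_simp
    linear_combination hAB
  have hfp : fp Jp = (fm Jm + fp Jp) * (lp Jm / (lp Jm + lm Jp)) := by
    field_simp
    linear_combination -hAB
  have hcm : 0 < lm Jp / (lp Jm + lm Jp) := by positivity
  have hcp : 0 < lp Jm / (lp Jm + lm Jp) := by positivity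
  have hq : 0 < ((lm xs) ^ 2)⁻¹ := by positivity
  rw [hsum] at hfm hfp
  rw [hPhi, hVW, hfm, hfp]
  refine ⟨fun h => ?_, fun h => ?_, fun h => ?_⟩
  · have hD := mul_pos hVC (sub_pos.2 ((ENNReal.ofReal_lt_ofReal_iff hq).1 h))
    exact ⟨mul_pos hD hcm, mul_pos hD hcp⟩
  · have h0 : 0 < R := ENNReal.ofReal_pos.1 (h ▸ ENNReal.ofReal_pos.2 hq)
    have hRq : R = ((lm xs) ^ 2)⁻¹ := (ENNReal.ofReal_eq_ofReal_iff h0.le hq.le).1 h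
    simp [hRq]
  · have hD := mul_neg_of_pos_of_neg hVC (sub_neg.2 (ENNReal.ofReal_lt_ofReal_iff'.1 h).1)
    exact ⟨mul_neg_of_neg_of_pos hD hcm, mul_neg_of_neg_of_pos hD hcp⟩
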